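/- Let n be a positive integer. In the Kiselman monoid K_n, for all subsets X, Y ⊆ {1,…,n}, both products ε_{X∪Y}·ε_X and ε_Y·ε_{X∪Y} are idempotent elements. -/

import Mathlib

/-- The defining relations of the Kiselman monoid `K_k`:
`a_i² = a_i`, and `a_i a_j a_i = a_j a_i a_j = a_i a_j` for `i > j`. -/
inductive KisRel (k : ℕ) : FreeMonoid (Fin k) → FreeMonoid (Fin k) → Prop
  | idem (i : Fin k) :
      KisRel k (FreeMonoid.of i * FreeMonoid.of i) (FreeMonoid.of i)
  | braid_left {i j : Fin k} : j < i →
      KisRel k (FreeMonoid.of i * FreeMonoid.of j * FreeMonoid.of i)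
        (FreeMonoid.of i * FreeMonoid.of j)
  | braid_right {i j : Fin k} : j < i →
      KisRel k (FreeMonoid.of j * FreeMonoid.of i * FreeMonoid.of j)
        (FreeMonoid.of i * FreeMonoid.of j)

/-- The congruence generated by the Kiselman relations. -/
def kisCon (k : ℕ) : Con (FreeMonoid (Fin k)) := conGen (KisRel k)

/-- The Kiselman monoid `K_k`. -/
abbrev Kis (k : ℕ) : Type := (kisCon k).Quotient

/-- The generator `a i` of the Kiselman monoid. -/
def Kis.gen (k : ℕ) (i : Fin k) : Kis k := (kisCon k).mk' (FreeMonoid.of i)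

/-- `ε_X = a_{i_k} ⋯ a_{i_2} a_{i_1}` for `X = {i_1 < i_2 < ⋯ < i_k}`, and `ε_∅ = 1`. -/
def Kis.eps {k : ℕ} (X : Finset (Fin k)) : Kis k :=
  (((X.sort (· ≤ ·)).reverse).map (Kis.gen k)).prod

namespace Kis

variable {k : ℕ}

theorem gen_mul_self (i : Fin k) : gen k i * gen k i = gen k i :=
  (Con.eq _).2 (ConGen.Rel.of _ _ (KisRel.idem i))

theorem gen_mul_gen_mul_gen_of_le {i j : Fin k} (h : j ≤ i) :
    gen k i * gen k j * gen k i = gen k i * gen k j := by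
  rcases h.eq_or_lt with rfl | h
  · rw [gen_mul_self, gen_mul_self]
  · exact (Con.eq _).2 (ConGen.Rel.of _ _ (KisRel.braid_left h))

theorem gen_mul_gen_mul_gen_of_ge {i j : Fin k} (h : i ≤ j) :
    gen k i * gen k j * gen k i = gen k j * gen k i := by
  rcases h.eq_or_lt with rfl | h
  · rw [gen_mul_self, gen_mul_self]
  · exact (Con.eq _).2 (ConGen.Rel.of _ _ (KisRel.braid_right h))

/-- The submonoid generated by the generators with index in `s`. -/
def gens (s : Set (Fin k)) : Submonoid (Kis k) := Submonoid.closure (gen k '' s)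

theorem gen_mem_gens {s : Set (Fin k)} {i : Fin k} (h : i ∈ s) : gen k i ∈ gens s :=
  Submonoid.subset_closure ⟨i, h, rfl⟩

theorem eps_mem_gens {s : Set (Fin k)} {X : Finset (Fin k)} (h : ∀ x ∈ X, x ∈ s) :
    eps X ∈ gens s := by
  refine Submonoid.list_prod_mem _ fun y hy => ?_
  simp only [List.mem_map, List.mem_reverse, Finset.mem_sort] at hy
  obtain ⟨x, hx, rfl⟩ := hy
  exact gen_mem_gens (h x hx)

/-- A generator absorbs later copies of itself across letters of smaller index. -/
theorem gen_mul_mul_gen_of_le {i : Fin k} {u : Kis k} (hu : u ∈ gens (Set.Iic i)) :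
    gen k i * u * gen k i = gen k i * u := by
  induction hu using Submonoid.closure_induction_right with
  | one => rw [mul_one, gen_mul_self]
  | mul_right v _ y hy ih =>
    obtain ⟨j, hj, rfl⟩ := hy
    calc gen k i * (v * gen k j) * gen k i
        = gen k i * v * gen k j * gen k i := by simp only [mul_assoc]
      _ = gen k i * v * (gen k i * gen k j * gen k i) := by
        simp only [← mul_assoc, ih]
      _ = gen k i * v * gen k i * gen k j := by
        rw [gen_mul_gen_mul_gen_of_le hj]; simp only [mul_assoc]
      _ = gen k i * (v * gen k j) := by rw [ih, mul_assoc]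

/-- A generator absorbs earlier copies of itself across letters of larger index. -/
theorem gen_mul_mul_gen_of_ge {i : Fin k} {u : Kis k} (hu : u ∈ gens (Set.Ici i)) :
    gen k i * u * gen k i = u * gen k i := by
  induction hu using Submonoid.closure_induction_left with
  | one => rw [mul_one, one_mul, gen_mul_self]
  | mul_left y hy v _ ih =>
    obtain ⟨j, hj, rfl⟩ := hy
    calc gen k i * (gen k j * v) * gen k i
        = gen k i * gen k j * (v * gen k i) := by simp only [mul_assoc]
      _ = (gen k i * gen k j * gen k i) * (v * gen k i) := by
        conv_lhs => rw [← ih]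
        simp only [mul_assoc]
      _ = gen k j * (gen k i * v * gen k i) := by
        rw [gen_mul_gen_mul_gen_of_ge hj]; simp only [mul_assoc]
      _ = gen k j * v * gen k i := by rw [ih, mul_assoc]

@[simp]
theorem eps_empty : eps (∅ : Finset (Fin k)) = 1 := by simp [eps]

theorem eps_insert_of_lt {m : Fin k} {Z : Finset (Fin k)} (h : ∀ x ∈ Z, m < x) :
    eps (insert m Z) = eps Z * gen k m := by
  rw [eps, Finset.sort_insert _ (fun x hx => (h x hx).le) fun hm => (h m hm).false]
  simp [eps]

theorem eps_insert_of_gt {m : Fin k} {Z : Finset (Fin k)} (h : ∀ x ∈ Z, x < m) :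
    eps (insert m Z) = gen k m * eps Z := by
  induction Z using Finset.induction_on_min with
  | empty => simpa using eps_insert_of_lt (m := m) (Z := ∅) (by simp)
  | insert a Z ha ih =>
    simp only [Finset.forall_mem_insert] at h
    rw [Finset.insert_comm, eps_insert_of_lt (Finset.forall_mem_insert _ _ _ |>.2 ⟨h.1, ha⟩),
      ih h.2, eps_insert_of_lt ha, mul_assoc]

theorem gen_mul_mul_eps {m : Fin k} {u : Kis k} (hu : u ∈ gens (Set.Iic m))
    {X : Finset (Fin k)} (hX : ∀ x ∈ X, x ≤ m) :
    gen k m * u * eps X = gen k m * u * eps (X.erase m) := by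
  by_cases hm : m ∈ X
  · conv_lhs => rw [← Finset.insert_erase hm]
    rw [eps_insert_of_gt fun x hx => lt_of_le_of_ne (hX x (Finset.mem_of_mem_erase hx))
      (Finset.ne_of_mem_erase hx), ← mul_assoc, gen_mul_mul_gen_of_le hu]
  · rw [Finset.erase_eq_of_notMem hm]

theorem eps_mul_mul_gen {m : Fin k} {u : Kis k} (hu : u ∈ gens (Set.Ici m))
    {X : Finset (Fin k)} (hX : ∀ x ∈ X, m ≤ x) :
    eps X * (u * gen k m) = eps (X.erase m) * (u * gen k m) := by
  by_cases hm : m ∈ X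
  · conv_lhs => rw [← Finset.insert_erase hm]
    rw [eps_insert_of_lt fun x hx => lt_of_le_of_ne (hX x (Finset.mem_of_mem_erase hx))
      (Finset.ne_of_mem_erase hx).symm, mul_assoc, ← mul_assoc (gen k m),
      gen_mul_mul_gen_of_ge hu]
  · rw [Finset.erase_eq_of_notMem hm]

theorem isIdempotentElem_eps_mul_eps_of_subset_left {X Z : Finset (Fin k)} (h : X ⊆ Z) :
    IsIdempotentElem (eps Z * eps X) := by
  induction Z using Finset.induction_on_max generalizing X with
  | empty => simp [Finset.subset_empty.1 h, IsIdempotentElem]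
  | insert m Z hm ih =>
    have hZ : eps Z ∈ gens (Set.Iic m) := eps_mem_gens fun x hx => (hm x hx).le
    have hX' : X.erase m ⊆ Z := Finset.subset_insert_iff.1 h
    have hX : ∀ x ∈ X, x ≤ m := fun x hx =>
      (Finset.mem_insert.1 (h hx)).elim (fun e => e.le) fun hx => (hm x hx).le
    have hX'' : eps (X.erase m) ∈ gens (Set.Iic m) :=
      eps_mem_gens fun x hx => (hm x (hX' hx)).le
    have hred := gen_mul_mul_eps hZ hX
    have key := ih hX'
    rw [IsIdempotentElem, eps_insert_of_gt hm, hred]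
    have hu := mul_mem hZ hX''
    calc gen k m * eps Z * eps (X.erase m) * (gen k m * eps Z * eps (X.erase m))
        = gen k m * (eps Z * eps (X.erase m)) * gen k m * (eps Z * eps (X.erase m)) := by
          simp only [mul_assoc]
      _ = gen k m * (eps Z * eps (X.erase m) * (eps Z * eps (X.erase m))) := by
          rw [gen_mul_mul_gen_of_le hu, mul_assoc]
      _ = gen k m * eps Z * eps (X.erase m) := by rw [key.eq, mul_assoc]

theorem isIdempotentElem_eps_mul_eps_of_subset_right {X Z : Finset (Fin k)} (h : X ⊆ Z) :
    IsIdempotentElem (eps X * eps Z) := by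
  induction Z using Finset.induction_on_min generalizing X with
  | empty => simp [Finset.subset_empty.1 h, IsIdempotentElem]
  | insert m Z hm ih =>
    have hZ : eps Z ∈ gens (Set.Ici m) := eps_mem_gens fun x hx => (hm x hx).le
    have hX' : X.erase m ⊆ Z := Finset.subset_insert_iff.1 h
    have hX : ∀ x ∈ X, m ≤ x := fun x hx =>
      (Finset.mem_insert.1 (h hx)).elim (fun e => e.ge) fun hx => (hm x hx).le
    have hX'' : eps (X.erase m) ∈ gens (Set.Ici m) :=
      eps_mem_gens fun x hx => (hm x (hX' hx)).le
    have hred := eps_mul_mul_gen hZ hX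
    have key := ih hX'
    rw [IsIdempotentElem, eps_insert_of_lt hm, hred]
    have hu := mul_mem hX'' hZ
    calc eps (X.erase m) * (eps Z * gen k m) * (eps (X.erase m) * (eps Z * gen k m))
        = eps (X.erase m) * eps Z * (gen k m * (eps (X.erase m) * eps Z) * gen k m) := by
          simp only [mul_assoc]
      _ = eps (X.erase m) * eps Z * (eps (X.erase m) * eps Z) * gen k m := by
          rw [gen_mul_mul_gen_of_ge hu]; simp only [mul_assoc]
      _ = eps (X.erase m) * (eps Z * gen k m) := by rw [key.eq, mul_assoc]

end Kis

theorem stmt0 (n : ℕ) (hn : 0 < n) (X Y : Finset (Fin n)) :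
    IsIdempotentElem (Kis.eps (X ∪ Y) * Kis.eps X) ∧
    IsIdempotentElem (Kis.eps Y * Kis.eps (X ∪ Y)) :=
  ⟨Kis.isIdempotentElem_eps_mul_eps_of_subset_left Finset.subset_union_left,
    Kis.isIdempotentElem_eps_mul_eps_of_subset_right Finset.subset_union_right⟩
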